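/- Let G be a finite simple cubic bridgeless graph, (G_0, G_i, P_i)^l an odd ear decomposition of G, and M a perfect matching of G that is absolute in it. Then there exists a (G_1, M)-ear square graph Q_1 that can be generated from the ladder L_8 on 8 vertices by a sequence of type-1 augmentations. -/

import Mathlib

open SimpleGraph

namespace Hex

variable {V : Type}

/-- A graph is cubic (3-regular) if every vertex has exactly 3 neighbors. -/
def IsCubic (G : SimpleGraph V) : Prop := ∀ v : V, (G.neighborSet v).ncard = 3

/-- A graph is bridgeless if none of its edges is a bridge. -/
def Bridgeless (G : SimpleGraph V) : Prop := ∀ e ∈ G.edgeSet, ¬G.IsBridge e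

/-- A valid assignment of the indices `i_{v(u)} ∈ {0,1,2}`: with each neighbor `u` of `v`
an index in `{0,1,2}` is associated, pairwise distinct for distinct neighbors. -/
def GoodIdx (G : SimpleGraph V) (idx : V → V → ZMod 6) : Prop :=
  (∀ v u : V, G.Adj v u → (idx v u).val < 3) ∧
  (∀ v u w : V, G.Adj v u → G.Adj v w → u ≠ w → idx v u ≠ idx v w)

/-- The pair of white edges `(e_{uv}, e'_{uv})` replacing the edge `uv` of `G`.
A vertex `v_i` belongs to the class `X` iff `i` is even, to `Y` iff `i` is odd. -/
def whitePairs (idx : V → V → ZMod 6) (u v : V) :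
    Sym2 (V × ZMod 6) × Sym2 (V × ZMod 6) :=
  if (idx u v).val % 2 = (idx v u).val % 2 then
    (s((u, idx u v), (v, idx v u + 3)), s((u, idx u v + 3), (v, idx v u)))
  else
    (s((u, idx u v), (v, idx v u)), s((u, idx u v + 3), (v, idx v u + 3)))

/-- The white edges of the hexagon graph. -/
def IsWhite (G : SimpleGraph V) (idx : V → V → ZMod 6) (e : Sym2 (V × ZMod 6)) : Prop :=
  ∃ u v : V, G.Adj u v ∧ (e = (whitePairs idx u v).1 ∨ e = (whitePairs idx u v).2)

/-- The red edges of the hexagon graph: the edges `v_i v_{i+3}`. -/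
def IsRed (e : Sym2 (V × ZMod 6)) : Prop :=
  ∃ (v : V) (i : ZMod 6), e = s((v, i), (v, i + 3))

/-- The blue edges of the hexagon graph: the edges `v_i v_{i+1}`. -/
def IsBlue (e : Sym2 (V × ZMod 6)) : Prop :=
  ∃ (v : V) (i : ZMod 6), e = s((v, i), (v, i + 1))

/-- The hexagon graph of `G` with respect to an index assignment `idx`: each vertex `v` of `G`
is replaced by a hexagon (a copy of `K_{3,3}` with vertex set `{v} × ZMod 6`, and edge set
`{v_i v_{i+1}} ∪ {v_i v_{i+3}}`), and each edge `uv` of `G` is replaced by the two white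
edges `e_{uv}`, `e'_{uv}`. -/
def hexagonGraph (G : SimpleGraph V) (idx : V → V → ZMod 6) : SimpleGraph (V × ZMod 6) :=
  SimpleGraph.fromRel fun p q =>
    (p.1 = q.1 ∧ (q.2 = p.2 + 1 ∨ q.2 = p.2 + 3)) ∨ IsWhite G idx s(p, q)

/-- A blue perfect matching of the hexagon graph: a perfect matching all of whose edges
are blue. -/
def IsBluePM (G : SimpleGraph V) (idx : V → V → ZMod 6)
    (M : (hexagonGraph G idx).Subgraph) : Prop :=
  M.IsPerfectMatching ∧ ∀ e ∈ M.edgeSet, IsBlue e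

/-- The graph `M Δ W` on the vertices of the hexagon graph, whose edge set is the symmetric
difference of the edge set of `M` and the set `W` of white edges. Its connected components
are the cycles of `M Δ W`. -/
def sdGraph (G : SimpleGraph V) (idx : V → V → ZMod 6)
    (M : (hexagonGraph G idx).Subgraph) : SimpleGraph (V × ZMod 6) :=
  SimpleGraph.fromEdgeSet (symmDiff M.edgeSet {e | IsWhite G idx e})

/-- The edge set of the subgraph of `G` induced by the cycle (connected component) `c`
of `M Δ W`: the edges `uv` of `G` such that `e_{uv}` or `e'_{uv}` belongs to `c`. -/
def inducedSet (G : SimpleGraph V) (idx : V → V → ZMod 6)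
    (M : (hexagonGraph G idx).Subgraph)
    (c : (sdGraph G idx M).ConnectedComponent) : Set (Sym2 V) :=
  {e | ∃ (u v : V) (i j : ZMod 6), (sdGraph G idx M).Adj (u, i) (v, j) ∧ u ≠ v ∧
    (sdGraph G idx M).connectedComponentMk (u, i) = c ∧ e = s(u, v)}

/-- A rotation system of `G`: for each vertex `v`, a cyclic permutation of the edges
incident with `v` (encoded on darts with tail `v`). -/
structure RotationSystem (G : SimpleGraph V) where
  σ : G.Dart ≃ G.Dart
  tail_eq : ∀ d : G.Dart, (σ d).toProd.1 = d.toProd.1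
  cyclic : ∀ d d' : G.Dart, d.toProd.1 = d'.toProd.1 → ∃ n : ℕ, (⇑σ)^[n] d = d'

/-- The face-traversal map of a rotation system: after traversing the dart `d = (v, w)`,
the next dart is obtained by applying the rotation at `w` to the edge of `d`. -/
def facePerm {G : SimpleGraph V} (ρ : RotationSystem G) : G.Dart → G.Dart :=
  fun d => ρ.σ d.symm

/-- The face boundaries of a rotation system, as edge sets of `G`. -/
def faceSets {G : SimpleGraph V} (ρ : RotationSystem G) : Set (Set (Sym2 V)) :=
  {S | ∃ d : G.Dart, S = {e | ∃ n : ℕ, ((facePerm ρ)^[n] d).edge = e}}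

/-- The cyclic shift `0 ↦ 1 ↦ 2 ↦ 0` on the index set `{0,1,2} ⊂ ZMod 6`. -/
def rot3 (a : ZMod 6) : ZMod 6 := if a = 2 then 0 else a + 1

/-- The cyclic shift `0 ↦ 2 ↦ 1 ↦ 0` on the index set `{0,1,2} ⊂ ZMod 6`. -/
def rot3inv (a : ZMod 6) : ZMod 6 := if a = 0 then 2 else a - 1

/-- An edge `e` belongs to the cycle (connected component) `c` of a graph `K`. -/
def edgeInComp {W : Type} (K : SimpleGraph W) (e : Sym2 W) (c : K.ConnectedComponent) :
    Prop :=
  e ∈ K.edgeSet ∧ ∀ x ∈ e, K.connectedComponentMk x = c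

/-- A blue perfect matching `M` is safe if no cycle of `M Δ W` contains both end vertices
of a red edge, i.e. no component of `M Δ W` contains both `(v, i)` and `(v, i + 3)`. -/
def SafePM (G : SimpleGraph V) (idx : V → V → ZMod 6)
    (M : (hexagonGraph G idx).Subgraph) : Prop :=
  ∀ (v : V) (i : ZMod 6), ¬(sdGraph G idx M).Reachable (v, i) (v, i + 3)

/-- A directed cycle double cover of `G`: a family of directed cycles (cycles traversed
in a chosen direction) such that every dart of `G` is traversed by exactly one member;
equivalently, every edge lies on exactly two members and they induce opposite
orientations on it. -/
def HasDCDC (G : SimpleGraph V) : Prop :=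
  ∃ (ι : Type) (F : ι → Σ v : V, G.Walk v v),
    (∀ i, (F i).2.IsCycle) ∧ ∀ d : G.Dart, ∃! i, d ∈ (F i).2.darts

/-- A brace: a simple connected bipartite graph on at least six vertices that has a
perfect matching and such that every pair of vertex-disjoint edges is contained in a
perfect matching. -/
def IsBrace {W : Type} [Fintype W] (H : SimpleGraph W) : Prop :=
  H.Connected ∧ H.Colorable 2 ∧ 6 ≤ Fintype.card W ∧
  (∃ M : H.Subgraph, M.IsPerfectMatching) ∧
  ∀ e₁ ∈ H.edgeSet, ∀ e₂ ∈ H.edgeSet, (∀ x ∈ e₁, x ∉ e₂) →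
    ∃ M : H.Subgraph, M.IsPerfectMatching ∧ e₁ ∈ M.edgeSet ∧ e₂ ∈ M.edgeSet

/-- The ladder `L_{2n}`: vertices `a_0, …, a_{n-1}, b_0, …, b_{n-1}`, with edges
`a_i a_{i+1}`, `b_i b_{i+1}` (indices mod `n`) and the rungs `a_i b_i`.
In particular `ladder 4` is the ladder `L_8` on 8 vertices. -/
def ladder (n : ℕ) : SimpleGraph (Fin 2 × ZMod n) :=
  SimpleGraph.fromRel fun p q => (p.1 = q.1 ∧ q.2 = p.2 + 1) ∨ (p.1 ≠ q.1 ∧ p.2 = q.2)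

/-- The expansion of a vertex `x` to a path `x¹ v x²`, relative to the part `N1` of a
partition `(N1, N(x) \ N1)` of the neighborhood of `x`: `x` is deleted, the new path
`x¹ v x²` is added (here `v := Sum.inl x`, `x¹ := Sum.inr 0`, `x² := Sum.inr 1`), every
vertex of `N1` is joined to `x¹` and every other neighbor of `x` is joined to `x²`. -/
def expansion {α : Type} (H : SimpleGraph α) (x : α) (N1 : Set α) :
    SimpleGraph (α ⊕ Fin 2) :=
  SimpleGraph.fromRel fun p q =>
    match p, q with
    | Sum.inl a, Sum.inl b => H.Adj a b ∧ a ≠ x ∧ b ≠ x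
    | Sum.inr i, Sum.inl a =>
        (a = x ∧ (i = 0 ∨ i = 1)) ∨ (i = 0 ∧ a ∈ N1 ∧ H.Adj x a) ∨
        (i = 1 ∧ a ∉ N1 ∧ H.Adj x a)
    | _, _ => False

/-- `H'` is obtained from `H` by a type-1 augmentation: one new edge is added so that the
result is bipartite (stated up to isomorphism). -/
def IsType1Aug {α β : Type} (H : SimpleGraph α) (H' : SimpleGraph β) : Prop :=
  ∃ x y : α, x ≠ y ∧ ¬H.Adj x y ∧
    (SimpleGraph.fromEdgeSet (insert s(x, y) H.edgeSet)).Colorable 2 ∧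
    Nonempty (H' ≃g SimpleGraph.fromEdgeSet (insert s(x, y) H.edgeSet))

/-- `H'` is obtained from `H` by a type-2 augmentation: a vertex `x` of degree at least 4
is expanded to `x¹ v x²` (with both parts of the neighborhood partition of size at least 2)
and a new edge `v w` is added, where `w` is a vertex in the same partition class as `x`
(stated up to isomorphism). -/
def IsType2Aug {α β : Type} (H : SimpleGraph α) (H' : SimpleGraph β) : Prop :=
  ∃ (x w : α) (N1 : Set α),
    4 ≤ (H.neighborSet x).ncard ∧ N1 ⊆ H.neighborSet x ∧ 2 ≤ N1.ncard ∧
    2 ≤ (H.neighborSet x \ N1).ncard ∧ w ≠ x ∧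
    (∃ C : H.Coloring (Fin 2), C w = C x) ∧
    Nonempty (H' ≃g SimpleGraph.fromEdgeSet
      (insert s(Sum.inl x, Sum.inl w) (expansion H x N1).edgeSet))

/-- A bundled graph (a graph together with its vertex type). -/
structure BundledGraph : Type 1 where
  carrier : Type
  graph : SimpleGraph carrier

/-- A simple augmentation: a type-1 or a type-2 augmentation. -/
def IsSimpleAug (A B : BundledGraph) : Prop :=
  IsType1Aug A.graph B.graph ∨ IsType2Aug A.graph B.graph

/-- The set of vertices of the square `s_v` that are covered by an edge of `S`
(for `S` the projection of an edge or path, these are the vertices of its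
supporting edge in `s_v`). -/
def sqSupp (v : V) (S : Set (Sym2 (V × ZMod 4))) : Set (V × ZMod 4) :=
  {p | p.1 = v ∧ ∃ e ∈ S, p ∈ e}

/-- An `M`-square graph of `G`: each vertex `v` of `G` is replaced by a square `s_v`
(a copy of `K_{2,2}` on `{v} × ZMod 4`, with edge set `{v_j v_{j+1}}`), and each edge `uv`
of `G` is replaced by its projection `pr u v`, a set of two edges forming, together with a
supporting edge in each of `s_u`, `s_v`, a copy of `K_{2,2}`; whenever `uv ∈ M` and `w, z`
are the other two neighbors of `v`, the supporting edges of `pr w v` and `pr z v` in `s_v`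
are vertex-disjoint. -/
structure SquareGraph (G : SimpleGraph V) (M : Set (Sym2 V)) where
  Q : SimpleGraph (V × ZMod 4)
  pr : V → V → Set (Sym2 (V × ZMod 4))
  bip : Q.Colorable 2
  intra : ∀ (v : V) (j k : ZMod 4), Q.Adj (v, j) (v, k) ↔ (k = j + 1 ∨ j = k + 1)
  pr_symm : ∀ u v : V, pr u v = pr v u
  pr_shape : ∀ u v : V, G.Adj u v → ∃ j k : ZMod 4,
    pr u v = {s((u, j), (v, k)), s((u, j + 1), (v, k + 1))} ∨
    pr u v = {s((u, j), (v, k)), s((u, j + 1), (v, k + 3))}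
  inter : ∀ (u v : V) (j k : ZMod 4), u ≠ v →
    (Q.Adj (u, j) (v, k) ↔ G.Adj u v ∧ s((u, j), (v, k)) ∈ pr u v)
  matched : ∀ v u w z : V, G.Adj v u → G.Adj v w → G.Adj v z → u ≠ w → u ≠ z → w ≠ z →
    s(u, v) ∈ M → Disjoint (sqSupp v (pr w v)) (sqSupp v (pr z v))

/-- An odd ear decomposition of `G`: a sequence of subgraphs `G_0, …, G_l` where `G_0` is
an even cycle, `G_l = G`, and each `G_i` is obtained from `G_{i-1}` by attaching an odd
path (ear) whose ends lie in `G_{i-1}` and which is otherwise disjoint from `G_{i-1}`. -/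
structure OddEarDecomp (G : SimpleGraph V) where
  l : ℕ
  Gs : Fin (l + 1) → G.Subgraph
  base : ∃ (v : V) (c : G.Walk v v), c.IsCycle ∧ Even c.length ∧ Gs 0 = c.toSubgraph
  top : Gs (Fin.last l) = ⊤
  ear : ∀ i : Fin l, ∃ (a b : V) (p : G.Walk a b),
    p.IsPath ∧ Odd p.length ∧
    a ∈ (Gs i.castSucc).verts ∧ b ∈ (Gs i.castSucc).verts ∧
    (∀ w ∈ p.support, w ≠ a → w ≠ b → w ∉ (Gs i.castSucc).verts) ∧
    (∀ e ∈ p.edges, e ∉ (Gs i.castSucc).edgeSet) ∧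
    Gs i.succ = Gs i.castSucc ⊔ p.toSubgraph

/-- A perfect matching `M` of `G` is absolute in an odd ear decomposition if its
restriction to each `G_i` is a perfect matching of `G_i`. -/
def AbsoluteIn {G : SimpleGraph V} (M : G.Subgraph) (D : OddEarDecomp G) : Prop :=
  ∀ i : Fin (D.l + 1), ∀ v ∈ (D.Gs i).verts, ∃! w : V, M.Adj v w ∧ (D.Gs i).Adj v w

/-- The set `V_3(K)` of vertices of degree 3 in the subgraph `K`. -/
def deg3 {G : SimpleGraph V} (K : G.Subgraph) : Set V :=
  {v | (K.neighborSet v).ncard = 3}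

/-- A member of `P(K)`: a path of `K` whose end vertices have degree 3 in `K` and all of
whose internal vertices have degree 2 in `K`. -/
def IsEarPath {G : SimpleGraph V} (K : G.Subgraph) {u v : V} (p : G.Walk u v) : Prop :=
  p.IsPath ∧ 0 < p.length ∧ (∀ e ∈ p.edges, e ∈ K.edgeSet) ∧
  u ∈ deg3 K ∧ v ∈ deg3 K ∧
  ∀ w ∈ p.support, w ≠ u → w ≠ v → (K.neighborSet w).ncard = 2

/-- A `(K, M)`-ear square graph (for `K` one of the graphs `G_i` of an ear decomposition):
each vertex `v` of degree 3 in `K` is replaced by a square `s_v` on `{v} × ZMod 4` (all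
other vertices of the ambient type are isolated), and each path `p(u,v) ∈ P(K)` is
replaced by its projected path `pr p`, a set of two edges forming, together with a
supporting edge in each of `s_u`, `s_v`, a copy of `K_{2,2}`; projected paths of distinct
paths are disjoint; and for every `v ∈ V_3(K)`, the two paths at `v` other than the
matching-path of `v` have vertex-disjoint supporting edges in `s_v`. -/
structure EarSquareGraph (G : SimpleGraph V) (K : G.Subgraph) (M : Set (Sym2 V)) where
  Q : SimpleGraph (V × ZMod 4)
  pr : ∀ {u v : V}, G.Walk u v → Set (Sym2 (V × ZMod 4))
  bip : Q.Colorable 2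
  isolated : ∀ (v : V) (j : ZMod 4) (q : V × ZMod 4), v ∉ deg3 K → ¬Q.Adj (v, j) q
  intra : ∀ v ∈ deg3 K, ∀ j k : ZMod 4, Q.Adj (v, j) (v, k) ↔ (k = j + 1 ∨ j = k + 1)
  pr_symm : ∀ {u v : V} (p : G.Walk u v), pr p.reverse = pr p
  pr_shape : ∀ {u v : V} (p : G.Walk u v), IsEarPath K p → ∃ j k : ZMod 4,
    pr p = {s((u, j), (v, k)), s((u, j + 1), (v, k + 1))} ∨
    pr p = {s((u, j), (v, k)), s((u, j + 1), (v, k + 3))}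
  pr_disjoint : ∀ {u v u' v' : V} (p : G.Walk u v) (q : G.Walk u' v'),
    IsEarPath K p → IsEarPath K q →
    (⟨u, v, p⟩ : Σ a b : V, G.Walk a b) ≠ ⟨u', v', q⟩ →
    (⟨u, v, p⟩ : Σ a b : V, G.Walk a b) ≠ ⟨v', u', q.reverse⟩ →
    Disjoint (pr p) (pr q)
  inter : ∀ (u v : V) (j k : ZMod 4), u ≠ v →
    (Q.Adj (u, j) (v, k) ↔ ∃ p : G.Walk u v, IsEarPath K p ∧ s((u, j), (v, k)) ∈ pr p)
  matched : ∀ (v y z : V) (q : G.Walk v y) (r : G.Walk v z),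
    IsEarPath K q → IsEarPath K r → q.getVert 1 ≠ r.getVert 1 →
    (∀ w : V, s(v, w) ∈ M → q.getVert 1 ≠ w ∧ r.getVert 1 ≠ w) →
    Disjoint (sqSupp v (pr q)) (sqSupp v (pr r))

section Theta

variable {G : SimpleGraph V} {K : G.Subgraph} {a b : V} {P : Fin 3 → G.Walk a b}

/-- `K` is the union of the three internally disjoint paths `P 0`, `P 1`, `P 2` joining two
distinct vertices `a` and `b`. -/
structure IsTheta (K : G.Subgraph) (a b : V) (P : Fin 3 → G.Walk a b) : Prop where
  ne : a ≠ b
  isPath : ∀ i, (P i).IsPath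
  adj_iff : ∀ x y, K.Adj x y ↔ ∃ i, (P i).toSubgraph.Adj x y
  support_inter : ∀ i j, i ≠ j → ∀ w ∈ (P i).support, w ∈ (P j).support → w = a ∨ w = b
  edges_inter : ∀ i j, i ≠ j → ∀ e ∈ (P i).edges, e ∉ (P j).edges

namespace IsTheta

lemma symm (h : IsTheta K a b P) : IsTheta K b a fun i => (P i).reverse where
  ne := h.ne.symm
  isPath i := (h.isPath i).reverse
  adj_iff x y := by simp only [Walk.toSubgraph_reverse, h.adj_iff]
  support_inter i j hij w hi hj := by
    simp only [Walk.support_reverse, List.mem_reverse] at hi hj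
    exact (h.support_inter i j hij w hi hj).symm
  edges_inter i j hij e hi hj := by
    simp only [Walk.edges_reverse, List.mem_reverse] at hi hj
    exact h.edges_inter i j hij e hi hj

lemma reindex (h : IsTheta K a b P) (σ : Equiv.Perm (Fin 3)) :
    IsTheta K a b fun i => P (σ i) where
  ne := h.ne
  isPath i := h.isPath _
  adj_iff x y := by
    rw [h.adj_iff]
    exact σ.surjective.exists
  support_inter i j hij := h.support_inter _ _ (σ.injective.ne hij)
  edges_inter i j hij := h.edges_inter _ _ (σ.injective.ne hij)

lemma not_nil (h : IsTheta K a b P) (i : Fin 3) : ¬(P i).Nil := Walk.not_nil_of_ne h.ne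

lemma mem_edgeSet (h : IsTheta K a b P) (i : Fin 3) : ∀ e ∈ (P i).edges, e ∈ K.edgeSet := by
  intro e he
  induction e with
  | _ x y => exact (h.adj_iff x y).2 ⟨i, Walk.adj_toSubgraph_iff_mem_edges.2 he⟩

lemma snd_injective (h : IsTheta K a b P) : Function.Injective fun i => (P i).snd := by
  intro i j hij
  by_contra hne
  refine h.edges_inter i j hne _ (Walk.mk_start_snd_mem_edges (h.not_nil i)) ?_
  simp only at hij
  rw [hij]
  exact Walk.mk_start_snd_mem_edges (h.not_nil j)

lemma injective (h : IsTheta K a b P) : Function.Injective P := fun i j hij =>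
  h.snd_injective (by simp only [hij])

lemma neighborSet_left (h : IsTheta K a b P) :
    K.neighborSet a = Set.range fun i => (P i).snd := by
  ext x
  simp only [Subgraph.mem_neighborSet, h.adj_iff, Set.mem_range]
  refine exists_congr fun i => ?_
  have := (h.isPath i).neighborSet_toSubgraph_startpoint (h.not_nil i)
  rw [← Subgraph.mem_neighborSet, this, Set.mem_singleton_iff, eq_comm]

lemma left_mem_deg3 (h : IsTheta K a b P) : a ∈ deg3 K := by
  change (K.neighborSet a).ncard = 3
  rw [h.neighborSet_left, ← Set.image_univ, Set.ncard_image_of_injective _ h.snd_injective]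
  simp

lemma right_mem_deg3 (h : IsTheta K a b P) : b ∈ deg3 K := h.symm.left_mem_deg3

lemma ncard_neighborSet_internal (h : IsTheta K a b P) {w : V} (ha : w ≠ a) (hb : w ≠ b)
    {i : Fin 3} (hw : w ∈ (P i).support) : (K.neighborSet w).ncard = 2 := by
  have : K.neighborSet w = (P i).toSubgraph.neighborSet w := by
    ext x
    simp only [Subgraph.mem_neighborSet, h.adj_iff]
    refine ⟨fun ⟨j, hj⟩ => ?_, fun hi => ⟨i, hi⟩⟩
    by_cases hij : i = j
    · exact hij ▸ hj
    · rcases h.support_inter i j hij w hw (Walk.mem_support_of_adj_toSubgraph hj) with h' | h'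
      · exact absurd h' ha
      · exact absurd h' hb
  obtain ⟨n, rfl, hn⟩ := Walk.mem_support_iff_exists_getVert.1 hw
  rw [this]
  refine (h.isPath i).ncard_neighborSet_toSubgraph_internal_eq_two ?_ ?_
  · rintro rfl
    exact ha (Walk.getVert_zero _)
  · refine lt_of_le_of_ne hn ?_
    rintro rfl
    exact hb (Walk.getVert_length _)

lemma deg3_eq (h : IsTheta K a b P) : deg3 K = {a, b} := by
  ext w
  refine ⟨fun hw => ?_, ?_⟩
  · by_contra hne
    simp only [Set.mem_insert_iff, Set.mem_singleton_iff, not_or] at hne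
    have hw : (K.neighborSet w).ncard = 3 := hw
    have hpos : (K.neighborSet w).Nonempty := by
      rw [Set.nonempty_iff_ne_empty]
      intro h0
      simp [h0] at hw
    obtain ⟨x, hx⟩ := hpos
    obtain ⟨i, hi⟩ := (h.adj_iff w x).1 hx
    have := h.ncard_neighborSet_internal hne.1 hne.2 (Walk.mem_support_of_adj_toSubgraph hi)
    omega
  · rintro (rfl | rfl)
    · exact h.left_mem_deg3
    · exact h.right_mem_deg3

lemma isEarPath (h : IsTheta K a b P) (i : Fin 3) : IsEarPath K (P i) :=
  ⟨h.isPath i, Walk.not_nil_iff_lt_length.1 (h.not_nil i), h.mem_edgeSet i, h.left_mem_deg3,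
    h.right_mem_deg3, fun _ hw ha hb => h.ncard_neighborSet_internal ha hb hw⟩

end IsTheta

/-- Two paths with a common end that leave `x` avoiding the neighbor `y` of `x` coincide if all
vertices of the second one except the common end have degree two. -/
lemma path_eq_of_ncard_two {x c y : V} (p q : G.Walk x c) (hy : K.Adj x y)
    (hp : p.IsPath) (hq : q.IsPath) (hyp : y ∉ p.support) (hyq : y ∉ q.support)
    (hpK : ∀ e ∈ p.edges, e ∈ K.edgeSet) (hqK : ∀ e ∈ q.edges, e ∈ K.edgeSet)
    (hdeg : ∀ w ∈ q.support, w ≠ c → (K.neighborSet w).ncard = 2) : p = q := by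
  induction q generalizing y with
  | nil => simpa using hp
  | @cons x x' c hxx' q ih =>
    rw [Walk.cons_isPath_iff] at hq
    have hxc : x ≠ c := by
      rintro rfl
      exact hq.2 q.end_mem_support
    cases p with
    | nil => exact absurd rfl hxc
    | @cons _ x'' _ hxx'' p =>
      rw [Walk.cons_isPath_iff] at hp
      simp only [Walk.support_cons, List.mem_cons, not_or] at hyp hyq
      simp only [Walk.edges_cons, List.mem_cons, forall_eq_or_imp, Subgraph.mem_edgeSet]
        at hpK hqK
      have hcard := hdeg x (by simp) hxc
      obtain ⟨s, t, -, hst⟩ := Set.ncard_eq_two.1 hcard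
      have hmem : ∀ z, K.Adj x z → z = s ∨ z = t := fun z hz => by
        have : z ∈ K.neighborSet x := hz
        simpa [hst] using this
      have h1 : y ≠ x' := by
        rintro rfl
        exact hyq.2 q.start_mem_support
      have h2 : y ≠ x'' := by
        rintro rfl
        exact hyp.2 p.start_mem_support
      have heq : x'' = x' := by
        have := hmem _ hy
        have := hmem _ hpK.1
        have := hmem _ hqK.1
        grind
      subst heq
      congr 1
      exact ih p hpK.1.symm hp.1 hq.1 hp.2 hq.2 hpK.2 hqK.2
        fun w hw => hdeg w (by simp [hw])

namespace IsTheta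

lemma eq_of_isEarPath (h : IsTheta K a b P) {p : G.Walk a b} (hp : IsEarPath K p) :
    ∃ i, p = P i := by
  have hadj : p.snd ∈ K.neighborSet a :=
    hp.2.2.1 _ (Walk.mk_start_snd_mem_edges (Walk.not_nil_of_ne h.ne))
  rw [h.neighborSet_left] at hadj
  obtain ⟨i, hi⟩ := hadj
  replace hi : (P i).snd = p.snd := hi
  refine ⟨i, ?_⟩
  have hP := h.isEarPath i
  generalize P i = q at hi hP
  cases p with
  | nil => exact absurd rfl h.ne
  | cons hx p =>
    cases q with
    | nil => exact absurd rfl h.ne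
    | cons hx' q =>
      simp only [Walk.snd_cons] at hi
      subst hi
      obtain ⟨hp1, -, hpK, -⟩ := hp
      obtain ⟨hq1, -, hqK, -, -, hdeg⟩ := hP
      rw [Walk.cons_isPath_iff] at hp1 hq1
      simp only [Walk.edges_cons, List.mem_cons, forall_eq_or_imp, Subgraph.mem_edgeSet]
        at hpK hqK
      congr 1
      refine path_eq_of_ncard_two p q hpK.1.symm hp1.1 hq1.1 hp1.2 hq1.2 hpK.2 hqK.2 ?_
      intro w hw hwb
      refine hdeg w (by simp [hw]) ?_ hwb
      rintro rfl
      exact hq1.2 hw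

end IsTheta

lemma IsEarPath.ne {u v : V} {p : G.Walk u v} (hp : IsEarPath K p) : u ≠ v := by
  rintro rfl
  exact hp.2.1.ne' (Walk.length_eq_zero_iff.2 (Walk.isPath_iff_nil.1 hp.1))

lemma IsEarPath.reverse {u v : V} {p : G.Walk u v} (hp : IsEarPath K p) :
    IsEarPath K p.reverse := by
  obtain ⟨h1, h2, h3, h4, h5, h6⟩ := hp
  refine ⟨h1.reverse, by simpa using h2, by simpa using h3, h5, h4, ?_⟩
  intro w hw hv hu
  exact h6 w (by simpa using hw) hu hv

/-- `p` is one of the two traversals of the path `P i`. -/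
def Traverses (P : Fin 3 → G.Walk a b) {u v : V} (p : G.Walk u v) (i : Fin 3) : Prop :=
  (⟨u, v, p⟩ : Σ x y : V, G.Walk x y) = ⟨a, b, P i⟩ ∨
    (⟨u, v, p⟩ : Σ x y : V, G.Walk x y) = ⟨b, a, (P i).reverse⟩

lemma Traverses.reverse {u v : V} {p : G.Walk u v} {i : Fin 3} (h : Traverses P p i) :
    Traverses P p.reverse i := by
  rcases h with h | h <;> cases h
  · exact Or.inr rfl
  · exact Or.inl (by rw [Walk.reverse_reverse])

lemma traverses_reverse {u v : V} {p : G.Walk u v} {i : Fin 3} :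
    Traverses P p.reverse i ↔ Traverses P p i :=
  ⟨fun h => by simpa using h.reverse, Traverses.reverse⟩

lemma IsTheta.traverses_unique (h : IsTheta K a b P) {u v : V} {p : G.Walk u v} {i j : Fin 3}
    (hi : Traverses P p i) (hj : Traverses P p j) : i = j := by
  have hne := h.ne
  rcases hi with hi | hi <;> cases hi <;> rcases hj with hj | hj
  · exact h.injective (by simpa using hj)
  · exact absurd (congrArg Sigma.fst hj) hne
  · exact absurd (congrArg Sigma.fst hj).symm hne
  · exact h.injective (Walk.reverse_injective (by simpa using hj))

lemma IsTheta.exists_traverses (h : IsTheta K a b P) {u v : V} {p : G.Walk u v}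
    (hp : IsEarPath K p) : ∃ i, Traverses P p i := by
  have hu := hp.2.2.2.1
  have hv := hp.2.2.2.2.1
  have hne := hp.ne
  rw [h.deg3_eq] at hu hv
  rcases hu with rfl | rfl <;> rcases hv with rfl | rfl
  · exact absurd rfl hne
  · obtain ⟨i, rfl⟩ := h.eq_of_isEarPath hp
    exact ⟨i, Or.inl rfl⟩
  · obtain ⟨i, hi⟩ := h.eq_of_isEarPath hp.reverse
    exact ⟨i, Or.inr (by rw [← hi, Walk.reverse_reverse])⟩
  · exact absurd rfl hne

end Theta

section Model

variable {a b : V}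

/-- The edges from the square of `a` to the square of `b` replacing the `i`-th path. -/
def thetaLink (i : Fin 3) (j k : ZMod 4) : Prop :=
  (j = ![0, 2, 0] i ∧ k = ![0, 2, 2] i) ∨ (j = ![0, 2, 0] i + 1 ∧ k = ![0, 2, 2] i + 1)

instance (i : Fin 3) (j k : ZMod 4) : Decidable (thetaLink i j k) :=
  inferInstanceAs (Decidable (_ ∨ _))

/-- The projected path of the `i`-th path. -/
def thetaProj (a b : V) (i : Fin 3) : Set (Sym2 (V × ZMod 4)) :=
  {e | ∃ j k, thetaLink i j k ∧ e = s((a, j), (b, k))}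

lemma thetaProj_eq (a b : V) (i : Fin 3) : thetaProj a b i =
    {s((a, ![0, 2, 0] i), (b, ![0, 2, 2] i)),
      s((a, ![0, 2, 0] i + 1), (b, ![0, 2, 2] i + 1))} := by
  ext e
  simp only [thetaProj, thetaLink, Set.mem_ofPred_eq, Set.mem_insert_iff, Set.mem_singleton_iff]
  constructor
  · rintro ⟨j, k, ⟨rfl, rfl⟩ | ⟨rfl, rfl⟩, rfl⟩
    · exact Or.inl rfl
    · exact Or.inr rfl
  · rintro (rfl | rfl)
    · exact ⟨_, _, Or.inl ⟨rfl, rfl⟩, rfl⟩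
    · exact ⟨_, _, Or.inr ⟨rfl, rfl⟩, rfl⟩

lemma mk_mem_thetaProj (hab : a ≠ b) {i : Fin 3} {j k : ZMod 4} :
    s((a, j), (b, k)) ∈ thetaProj a b i ↔ thetaLink i j k := by
  constructor
  · rintro ⟨j', k', h, he⟩
    simp only [Sym2.eq_iff, Prod.mk.injEq] at he
    rcases he with ⟨⟨-, rfl⟩, -, rfl⟩ | ⟨⟨h', -⟩, -⟩
    · exact h
    · exact absurd h' hab
  · intro h
    exact ⟨j, k, h, rfl⟩

lemma thetaLink_unique : ∀ i i' j k, thetaLink i j k → thetaLink i' j k → i = i' := by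
  decide

lemma thetaProj_disjoint (hab : a ≠ b) {i i' : Fin 3} (h : i ≠ i') :
    Disjoint (thetaProj a b i) (thetaProj a b i') := by
  rw [Set.disjoint_left]
  rintro _ ⟨j, k, hl, rfl⟩ h'
  exact h (thetaLink_unique _ _ _ _ hl ((mk_mem_thetaProj hab).1 h'))

lemma mem_sqSupp_left (hab : a ≠ b) {i : Fin 3} {p : V × ZMod 4}
    (hp : p ∈ sqSupp a (thetaProj a b i)) : ∃ k, thetaLink i p.2 k := by
  obtain ⟨hp1, e, ⟨j, k, hl, rfl⟩, hmem⟩ := hp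
  rcases Sym2.mem_iff.1 hmem with rfl | rfl
  · exact ⟨k, hl⟩
  · exact absurd hp1.symm hab

lemma mem_sqSupp_right (hab : a ≠ b) {i : Fin 3} {p : V × ZMod 4}
    (hp : p ∈ sqSupp b (thetaProj a b i)) : ∃ j, thetaLink i j p.2 := by
  obtain ⟨hp1, e, ⟨j, k, hl, rfl⟩, hmem⟩ := hp
  rcases Sym2.mem_iff.1 hmem with rfl | rfl
  · exact absurd hp1 hab
  · exact ⟨j, hl⟩

lemma thetaLink_left_disjoint : ∀ i i' : Fin 3, i ≠ i' → i ≠ 2 → i' ≠ 2 → ∀ j k k',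
    thetaLink i j k → ¬thetaLink i' j k' := by
  decide

lemma thetaLink_right_disjoint : ∀ i i' c : Fin 3, i ≠ i' → c ≠ 0 → i ≠ c → i' ≠ c →
    ∀ k j j', thetaLink i j k → ¬thetaLink i' j' k := by
  decide

/-- The model of the ear square graph of a theta graph. -/
def thetaModel : SimpleGraph (Fin 2 × ZMod 4) where
  Adj p q := (p.1 = q.1 ∧ (q.2 = p.2 + 1 ∨ p.2 = q.2 + 1)) ∨
    (p.1 = 0 ∧ q.1 = 1 ∧ ∃ i, thetaLink i p.2 q.2) ∨
    (p.1 = 1 ∧ q.1 = 0 ∧ ∃ i, thetaLink i q.2 p.2)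
  symm := ⟨by
    rintro p q (⟨h, h'⟩ | ⟨h, h'⟩ | ⟨h, h'⟩)
    · exact Or.inl ⟨h.symm, h'.symm⟩
    · exact Or.inr (Or.inr ⟨h'.1, h, h'.2⟩)
    · exact Or.inr (Or.inl ⟨h'.1, h, h'.2⟩)⟩
  loopless := ⟨by decide⟩

instance : DecidableRel thetaModel.Adj := fun _ _ => inferInstanceAs (Decidable (_ ∨ _))

lemma thetaModel_colorable : thetaModel.Colorable 2 :=
  ⟨Coloring.mk (fun p => if (p.1.val + p.2.val) % 2 = 0 then (0 : Fin 2) else 1) (by decide)⟩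

/-- The ear square graph of a theta graph on the ambient vertex type. -/
def thetaGraph (a b : V) (hab : a ≠ b) : SimpleGraph (V × ZMod 4) where
  Adj p q := (p.1 = q.1 ∧ (p.1 = a ∨ p.1 = b) ∧ (q.2 = p.2 + 1 ∨ p.2 = q.2 + 1)) ∨
    (p.1 = a ∧ q.1 = b ∧ ∃ i, thetaLink i p.2 q.2) ∨
    (p.1 = b ∧ q.1 = a ∧ ∃ i, thetaLink i q.2 p.2)
  symm := ⟨by
    rintro p q (⟨h, h', h''⟩ | ⟨h, h'⟩ | ⟨h, h'⟩)
    · exact Or.inl ⟨h.symm, h ▸ h', h''.symm⟩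
    · exact Or.inr (Or.inr ⟨h'.1, h, h'.2⟩)
    · exact Or.inr (Or.inl ⟨h'.1, h, h'.2⟩)⟩
  loopless := ⟨by
    rintro ⟨v, j⟩ (⟨-, -, h⟩ | ⟨h, h', -⟩ | ⟨h, h', -⟩)
    · have : ∀ j : ZMod 4, ¬(j = j + 1 ∨ j = j + 1) := by decide
      exact this j h
    · exact hab (h.symm.trans h')
    · exact hab (h'.symm.trans h)⟩

/-- The vertices of the two squares of `thetaGraph`. -/
def thetaEquiv [DecidableEq V] {S : Set V} (hab : a ≠ b) (hS : S = {a, b}) :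
    Fin 2 × ZMod 4 ≃ {x : V × ZMod 4 | x.1 ∈ S} where
  toFun p := ⟨(if p.1 = 0 then a else b, p.2), by
    subst hS
    by_cases h : p.1 = 0 <;> simp [h]⟩
  invFun x := (if x.1.1 = a then 0 else 1, x.1.2)
  left_inv := by
    rintro ⟨i, j⟩
    fin_cases i <;> simp [hab.symm]
  right_inv := by
    rintro ⟨⟨v, j⟩, hv⟩
    subst hS
    rcases hv with hv | hv <;> (simp only at hv; subst hv; simp [hab.symm])

/-- The nontrivial part of `thetaGraph` is isomorphic to `thetaModel`. -/
def thetaIso [DecidableEq V] {S : Set V} (hab : a ≠ b) (hS : S = {a, b}) :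
    thetaModel ≃g (thetaGraph a b hab).induce {x : V × ZMod 4 | x.1 ∈ S} where
  toEquiv := thetaEquiv hab hS
  map_rel_iff' := by
    rintro ⟨i, j⟩ ⟨i', j'⟩
    have hba := hab.symm
    fin_cases i <;> fin_cases i' <;>
      simp [thetaEquiv, thetaGraph, thetaModel, hab, hba]

lemma thetaGraph_colorable (hab : a ≠ b) : (thetaGraph a b hab).Colorable 2 := by
  classical
  refine ⟨Coloring.mk (fun p => if p.1 = a then
    (if p.2.val % 2 = 0 then (0 : Fin 2) else 1) else
    (if p.2.val % 2 = 0 then (1 : Fin 2) else 0)) ?_⟩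
  have h1 : ∀ j j' : ZMod 4, (j' = j + 1 ∨ j = j' + 1) → (j.val % 2 = 0 ↔ ¬ j'.val % 2 = 0) := by
    decide
  have h2 : ∀ j j' : ZMod 4, (∃ i, thetaLink i j j') → (j.val % 2 = 0 ↔ j'.val % 2 = 0) := by
    decide
  rintro ⟨u, j⟩ ⟨v, j'⟩ (⟨h, h', h''⟩ | ⟨h, h', h''⟩ | ⟨h, h', h''⟩) <;> simp only at h h' h''
  · subst h
    have := h1 _ _ h''
    grind
  · subst h h'
    have := h2 _ _ h''
    grind
  · subst h h'
    have := h2 _ _ h''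
    grind

end Model

section EarSquare

variable {G : SimpleGraph V} {K : G.Subgraph} {a b : V} {P : Fin 3 → G.Walk a b}

/-- The ear square graph of a theta graph, where the matching-path of `a` is `P 2` and the
matching-path of `b` is not `P 0`. -/
def thetaSquareGraph (M : G.Subgraph) (h : IsTheta K a b P) (hMa : M.Adj a (P 2).snd)
    (c : Fin 3) (hc : c ≠ 0) (hMb : M.Adj b (P c).reverse.snd) :
    EarSquareGraph G K M.edgeSet where
  Q := thetaGraph a b h.ne
  pr p := {e | ∃ i, Traverses P p i ∧ e ∈ thetaProj a b i}
  bip := thetaGraph_colorable h.ne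
  isolated := by
    rintro v j q hv hadj
    rw [h.deg3_eq] at hv
    simp only [Set.mem_insert_iff, Set.mem_singleton_iff, not_or] at hv
    rcases hadj with ⟨-, h' | h', -⟩ | ⟨h', -⟩ | ⟨h', -⟩
    · exact hv.1 h'
    · exact hv.2 h'
    · exact hv.1 h'
    · exact hv.2 h'
  intra := by
    rintro v hv j k
    rw [h.deg3_eq] at hv
    constructor
    · rintro (⟨-, -, h'⟩ | ⟨h1, h2, -⟩ | ⟨h1, h2, -⟩)
      · exact h'
      · exact absurd (h1.symm.trans h2) h.ne
      · exact absurd (h2.symm.trans h1) h.ne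
    · intro h'
      exact Or.inl ⟨rfl, hv, h'⟩
  pr_symm p := by simp only [traverses_reverse]
  pr_shape := by
    intro u v p hp
    obtain ⟨i, hi⟩ := h.exists_traverses hp
    have hpr : {e | ∃ i, Traverses P p i ∧ e ∈ thetaProj a b i} = thetaProj a b i := by
      ext e
      exact ⟨fun ⟨j, hj, he⟩ => h.traverses_unique hi hj ▸ he, fun he => ⟨i, hi, he⟩⟩
    rw [hpr, thetaProj_eq]
    rcases hi with hi | hi <;> cases hi
    · exact ⟨_, _, Or.inl rfl⟩
    · refine ⟨![0, 2, 2] i, ![0, 2, 0] i, Or.inl ?_⟩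
      rw [Sym2.eq_swap, Sym2.eq_swap (a := (b, ![0, 2, 2] i + 1))]
  pr_disjoint := by
    intro u v u' v' p q hp hq h1 h2
    rw [Set.disjoint_left]
    rintro e ⟨i, hi, he⟩ ⟨j, hj, he'⟩
    by_cases hij : i = j
    · subst hij
      rcases hi with hi | hi <;> rcases hj with hj | hj
      · exact h1 (hi.trans hj.symm)
      · cases hi
        cases hj
        exact h2 (by rw [Walk.reverse_reverse])
      · cases hi
        cases hj
        exact h2 rfl
      · exact h1 (hi.trans hj.symm)
    · exact Set.disjoint_left.1 (thetaProj_disjoint h.ne hij) he he'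
  inter := by
    intro u v j k huv
    constructor
    · rintro (⟨h', -⟩ | ⟨h1, h2, i, hi⟩ | ⟨h1, h2, i, hi⟩)
      · exact absurd h' huv
      · simp only at h1 h2 hi
        subst h1 h2
        exact ⟨P i, h.isEarPath i, i, Or.inl rfl, (mk_mem_thetaProj h.ne).2 hi⟩
      · simp only at h1 h2 hi
        subst h1 h2
        refine ⟨(P i).reverse, (h.isEarPath i).reverse, i, Or.inr rfl, ?_⟩
        rw [Sym2.eq_swap]
        exact (mk_mem_thetaProj h.ne).2 hi
    · rintro ⟨p, -, i, hi, he⟩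
      rcases hi with hi | hi <;> cases hi
      · exact Or.inr (Or.inl ⟨rfl, rfl, i, (mk_mem_thetaProj h.ne).1 he⟩)
      · rw [Sym2.eq_swap] at he
        exact Or.inr (Or.inr ⟨rfl, rfl, i, (mk_mem_thetaProj h.ne).1 he⟩)
  matched := by
    intro v y z q r hq hr hqr hM
    rw [Set.disjoint_left]
    rintro p ⟨hp, e, ⟨i, hi, he⟩, hpe⟩ ⟨-, e', ⟨i', hi', he'⟩, hpe'⟩
    rcases hi with hi | hi <;> cases hi <;> rcases hi' with hi' | hi'
    · cases hi'
      have hne : i ≠ i' := by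
        rintro rfl
        exact hqr rfl
      have h2 := hM _ hMa
      have hi2 : i ≠ 2 := by
        rintro rfl
        exact h2.1 rfl
      have hi2' : i' ≠ 2 := by
        rintro rfl
        exact h2.2 rfl
      obtain ⟨k, hk⟩ := mem_sqSupp_left h.ne ⟨hp, e, he, hpe⟩
      obtain ⟨k', hk'⟩ := mem_sqSupp_left h.ne ⟨hp, e', he', hpe'⟩
      exact thetaLink_left_disjoint i i' hne hi2 hi2' _ _ _ hk hk'
    · exact absurd (congrArg Sigma.fst hi') h.ne
    · exact absurd (congrArg Sigma.fst hi').symm h.ne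
    · cases hi'
      have hne : i ≠ i' := by
        rintro rfl
        exact hqr rfl
      have h2 := hM _ hMb
      have hi2 : i ≠ c := by
        rintro rfl
        exact h2.1 rfl
      have hi2' : i' ≠ c := by
        rintro rfl
        exact h2.2 rfl
      obtain ⟨k, hk⟩ := mem_sqSupp_right h.ne ⟨hp, e, he, hpe⟩
      obtain ⟨k', hk'⟩ := mem_sqSupp_right h.ne ⟨hp, e', he', hpe'⟩
      exact thetaLink_right_disjoint i i' c hne hc hi2 hi2' _ _ _ hk hk'

/-- The three graphs on the way from the ladder `L_8` to `thetaModel`. -/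
def ladderChain : Fin 3 → SimpleGraph (Fin 2 × ZMod 4) :=
  ![ladder 4, fromEdgeSet (insert s((0, 0), (1, 2)) (ladder 4).edgeSet), thetaModel]

lemma ladder_adj (p q : Fin 2 × ZMod 4) : (ladder 4).Adj p q ↔
    (p.1 = q.1 ∧ (q.2 = p.2 + 1 ∨ p.2 = q.2 + 1)) ∨ (p.1 ≠ q.1 ∧ p.2 = q.2) := by
  simp only [ladder, fromRel_adj]
  revert p q
  decide

lemma fromEdgeSet_insert_adj {W : Type*} (H : SimpleGraph W) (x y p q : W) :
    (fromEdgeSet (insert s(x, y) H.edgeSet)).Adj p q ↔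
      ((p = x ∧ q = y ∨ p = y ∧ q = x) ∨ H.Adj p q) ∧ p ≠ q := by
  simp only [fromEdgeSet_adj, Set.mem_insert_iff, mem_edgeSet, Sym2.eq_iff]

lemma thetaModel_eq : thetaModel = fromEdgeSet (insert s((0, 1), (1, 3))
    (fromEdgeSet (insert s((0, 0), (1, 2)) (ladder 4).edgeSet)).edgeSet) := by
  ext p q
  rw [fromEdgeSet_insert_adj, fromEdgeSet_insert_adj, ladder_adj]
  revert p q
  decide

lemma ladderChain_le (i : Fin 3) : ladderChain i ≤ thetaModel := by
  intro p q
  fin_cases i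
  · change (ladder 4).Adj p q → _
    rw [ladder_adj]
    revert p q
    decide
  · change (fromEdgeSet _).Adj p q → _
    rw [fromEdgeSet_insert_adj, ladder_adj]
    revert p q
    decide
  · exact id

lemma ladderChain_colorable (i : Fin 3) : (ladderChain i).Colorable 2 :=
  thetaModel_colorable.mono_left (ladderChain_le i)

lemma ladderChain_isType1Aug (i : Fin 2) :
    IsType1Aug (ladderChain i.castSucc) (ladderChain i.succ) := by
  fin_cases i
  · refine ⟨(0, 0), (1, 2), by decide, ?_, ladderChain_colorable 1, ⟨Iso.refl⟩⟩
    change ¬(ladder 4).Adj _ _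
    rw [ladder_adj]
    decide
  · refine ⟨(0, 1), (1, 3), by decide, ?_, ?_, ⟨?_⟩⟩
    · change ¬(fromEdgeSet _).Adj _ _
      rw [fromEdgeSet_insert_adj, ladder_adj]
      decide
    · exact thetaModel_eq ▸ thetaModel_colorable
    · exact thetaModel_eq ▸ Iso.refl

/-- Two distinct vertices of a cycle split it into two internally disjoint paths. -/
lemma exists_arcs [DecidableEq V] {v : V} {c : G.Walk v v} (hc : c.IsCycle) (ha : a ∈ c.support)
    (hb : b ∈ c.support) (hab : a ≠ b) :
    ∃ p q : G.Walk a b, p.IsPath ∧ q.IsPath ∧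
      (∀ w ∈ p.support, w ∈ q.support → w = a ∨ w = b) ∧
      (∀ e ∈ p.edges, e ∉ q.edges) ∧ p.toSubgraph ⊔ q.toSubgraph = c.toSubgraph := by
  have hc' : (c.rotate a ha).IsCycle := hc.rotate ha
  have hb' : b ∈ (c.rotate a ha).support := by
    rw [← Walk.mem_verts_toSubgraph, Walk.toSubgraph_rotate, Walk.mem_verts_toSubgraph]
    exact hb
  rw [← Walk.toSubgraph_rotate c ha]
  generalize c.rotate a ha = d at hc' hb'
  have hspec := d.take_spec hb'
  generalize d.takeUntil b hb' = p, d.dropUntil b hb' = q at hspec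
  subst hspec
  refine ⟨p, q.reverse, hc'.isPath_of_append_left (Walk.not_nil_of_ne hab.symm),
    (hc'.isPath_of_append_right (Walk.not_nil_of_ne hab)).reverse, ?_, ?_, ?_⟩
  · intro w hwp hwq
    rw [Walk.support_reverse, List.mem_reverse] at hwq
    by_contra! hw
    have hnd := hc'.support_nodup
    rw [Walk.tail_support_append, List.nodup_append] at hnd
    refine hnd.2.2 w ?_ w ?_ rfl
    · exact ((Walk.mem_support_iff _).1 hwp).resolve_left hw.1
    · exact ((Walk.mem_support_iff _).1 hwq).resolve_left hw.2
  · intro e hp hq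
    rw [Walk.edges_reverse, List.mem_reverse] at hq
    have hnd := hc'.edges_nodup
    rw [Walk.edges_append, List.nodup_append] at hnd
    exact hnd.2.2 e hp e hq rfl
  · rw [Walk.toSubgraph_reverse, Walk.toSubgraph_append]

/-- Attaching an ear to a cycle yields a theta graph. -/
lemma exists_isTheta [DecidableEq V] {v : V} {c : G.Walk v v} (hc : c.IsCycle)
    {p : G.Walk a b} (hp : p.IsPath) (hab : a ≠ b) (ha : a ∈ c.support) (hb : b ∈ c.support)
    (hsupp : ∀ w ∈ p.support, w ≠ a → w ≠ b → w ∉ c.support)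
    (hedges : ∀ e ∈ p.edges, e ∉ c.toSubgraph.edgeSet) :
    ∃ P : Fin 3 → G.Walk a b, IsTheta (c.toSubgraph ⊔ p.toSubgraph) a b P := by
  obtain ⟨q, r, hq, hr, hqr, hqr', hsup⟩ := exists_arcs hc ha hb hab
  have hqs : ∀ w ∈ q.support, w ∈ c.support := fun w hw => by
    rw [← Walk.mem_verts_toSubgraph] at hw ⊢
    exact hsup ▸ Or.inl hw
  have hrs : ∀ w ∈ r.support, w ∈ c.support := fun w hw => by
    rw [← Walk.mem_verts_toSubgraph] at hw ⊢
    exact hsup ▸ Or.inr hw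
  have hqe : ∀ e ∈ q.edges, e ∈ c.toSubgraph.edgeSet := fun e he => by
    rw [← hsup, Subgraph.edgeSet_sup]
    exact Or.inl ((Walk.mem_edges_toSubgraph q).2 he)
  have hre : ∀ e ∈ r.edges, e ∈ c.toSubgraph.edgeSet := fun e he => by
    rw [← hsup, Subgraph.edgeSet_sup]
    exact Or.inr ((Walk.mem_edges_toSubgraph r).2 he)
  refine ⟨![p, q, r], hab, ?_, ?_, ?_, ?_⟩
  · intro i
    fin_cases i
    exacts [hp, hq, hr]
  · intro x y
    rw [← hsup]
    simp only [Subgraph.sup_adj, Fin.exists_fin_succ, Matrix.cons_val_zero,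
      Matrix.cons_val_succ, IsEmpty.exists_iff, or_false]
    tauto
  · intro i j hij w hi hj
    have := hqs w
    have := hrs w
    have := hsupp w
    have := hqr w
    fin_cases i <;> fin_cases j <;> simp at hij hi hj <;> tauto
  · intro i j hij e hi hj
    have := hqe e
    have := hre e
    have := hedges e
    have := hqr' e
    fin_cases i <;> fin_cases j <;> simp at hij hi hj <;> tauto

/-- In a cubic graph, a perfect matching contains the first edge of one of the three paths. -/
lemma IsTheta.exists_matching_path [Finite V] (hG : IsCubic G) (h : IsTheta K a b P)
    {M : G.Subgraph} (hM : M.IsPerfectMatching) : ∃ i, M.Adj a (P i).snd := by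
  obtain ⟨m, hm, -⟩ := Subgraph.isPerfectMatching_iff.1 hM a
  have hsub : K.neighborSet a = G.neighborSet a :=
    Set.eq_of_subset_of_ncard_le (K.neighborSet_subset a)
      (by rw [hG a, show (K.neighborSet a).ncard = 3 from h.left_mem_deg3]) (Set.toFinite _)
  have hmem : m ∈ K.neighborSet a := by
    rw [hsub]
    exact hm.adj_sub
  rw [h.neighborSet_left] at hmem
  obtain ⟨i, rfl⟩ := hmem
  exact ⟨i, hm⟩

lemma IsTheta.exists_earSquareGraph [Finite V] [DecidableEq V] (hG : IsCubic G)
    (h : IsTheta K a b P) {M : G.Subgraph} (hM : M.IsPerfectMatching) :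
    ∃ Q : EarSquareGraph G K M.edgeSet,
      Nonempty (thetaModel ≃g Q.Q.induce {x : V × ZMod 4 | x.1 ∈ deg3 K}) := by
  obtain ⟨i, hi⟩ := h.exists_matching_path hG hM
  obtain ⟨j, hj⟩ := h.symm.exists_matching_path hG hM
  have key : ∀ i j : Fin 3, ∃ σ : Equiv.Perm (Fin 3), σ 2 = i ∧ σ 0 ≠ j := by decide
  obtain ⟨σ, rfl, hσ⟩ := key i j
  refine ⟨thetaSquareGraph M (h.reindex σ) hi (σ.symm j) ?_ (by simpa using hj),
    ⟨thetaIso h.ne h.deg3_eq⟩⟩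
  intro h0
  exact hσ (by rw [← h0, Equiv.apply_symm_apply])

end EarSquare

/-- some `(G_1, M)`-ear square graph can be generated from the ladder `L_8`
by a sequence of type-1 augmentations. -/
theorem stmt17 {V : Type} [Fintype V] [DecidableEq V] (G : SimpleGraph V)
    (hG : IsCubic G) (hB : Bridgeless G) (D : OddEarDecomp G) (hl : 1 ≤ D.l)
    (M : G.Subgraph) (hM : M.IsPerfectMatching) (hAbs : AbsoluteIn M D) :
    ∃ Q₁ : EarSquareGraph G (D.Gs ⟨1, by omega⟩) M.edgeSet,
      ∃ (k : ℕ) (Hs : Fin (k + 1) → BundledGraph),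
        Hs 0 = ⟨Fin 2 × ZMod 4, ladder 4⟩ ∧
        (∀ i : Fin (k + 1), (Hs i).graph.Colorable 2) ∧
        (∀ i : Fin k, IsType1Aug (Hs i.castSucc).graph (Hs i.succ).graph) ∧
        Nonempty ((Hs (Fin.last k)).graph ≃g
          Q₁.Q.induce {x : V × ZMod 4 | x.1 ∈ deg3 (D.Gs ⟨1, by omega⟩)}) := by
  obtain ⟨v, c, hc, -, h0⟩ := D.base
  obtain ⟨a, b, p, hp, hodd, ha, hb, hsupp, hedges, h1⟩ := D.ear ⟨0, hl⟩
  have hcast : D.Gs (Fin.castSucc ⟨0, hl⟩) = c.toSubgraph := h0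
  rw [hcast] at ha hb hsupp hedges h1
  simp only [Walk.mem_verts_toSubgraph] at ha hb hsupp
  have hab : a ≠ b := by
    rintro rfl
    rw [Walk.length_eq_zero_iff.2 (Walk.isPath_iff_nil.1 hp)] at hodd
    simp at hodd
  obtain ⟨P, hP⟩ := exists_isTheta hc hp hab ha hb hsupp hedges
  rw [← h1] at hP
  obtain ⟨Q, hQ⟩ := hP.exists_earSquareGraph hG hM
  exact ⟨Q, 2, fun i => ⟨_, ladderChain i⟩, rfl, ladderChain_colorable, ladderChain_isType1Aug, hQ⟩

end Hex
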